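/- Let Γ be a symmetric positive definite real n×n matrix, let C : ℝ → ℝ^{p×n} be entrywise continuous with ‖C(t)‖ ≤ β for all t ≥ 0 (operator norm) for some β > 0, and assume C satisfies PE(α,T) for some α, T > 0. Then there exist constants κ, λ > 0 such that every differentiable function θ̃ : [0,∞) → ℝⁿ satisfying the gradient-estimator error dynamics θ̃'(t) = −Γ C(t)ᵀ C(t) θ̃(t) for all t ≥ 0 obeys ‖θ̃(t)‖ ≤ κ e^{−λ (t − t₀)} ‖θ̃(t₀)‖ for all t ≥ t₀ ≥ 0; i.e., the origin of the error dynamics is globally uniformly exponentially stable. -/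

import Mathlib

open Matrix MeasureTheory

/-- The Euclidean norm of a finitely-indexed real vector. -/
noncomputable def euclNorm {ι : Type*} [Fintype ι] (v : ι → ℝ) : ℝ :=
  Real.sqrt (∑ i, v i ^ 2)

/-- A matrix-valued function `F` satisfies the persistency-of-excitation condition
`PE(α, T)`: for all `t ≥ 0`, `∫_t^{t+T} F(τ)ᵀ F(τ) dτ − α·Iₙ` is positive
semidefinite (the integral is taken entrywise). -/
def IsPE {p n : ℕ} (F : ℝ → Matrix (Fin p) (Fin n) ℝ) (α T : ℝ) : Prop :=
  ∀ t : ℝ, 0 ≤ t →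
    Matrix.PosSemidef
      ((Matrix.of fun i j => ∫ τ in t..(t + T), ((F τ)ᵀ * F τ) i j) -
        α • (1 : Matrix (Fin n) (Fin n) ℝ))

section EuclideanNorm

variable {ι : Type*} [Fintype ι]

theorem dotProduct_self_nonneg_real (v : ι → ℝ) : 0 ≤ v ⬝ᵥ v :=
  Finset.sum_nonneg fun i _ => mul_self_nonneg (v i)

theorem euclNorm_eq_sqrt_dotProduct (v : ι → ℝ) : euclNorm v = Real.sqrt (v ⬝ᵥ v) := by
  simp only [euclNorm, dotProduct, sq]

theorem euclNorm_nonneg (v : ι → ℝ) : 0 ≤ euclNorm v := Real.sqrt_nonneg _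

theorem euclNorm_sq (v : ι → ℝ) : euclNorm v ^ 2 = v ⬝ᵥ v := by
  rw [euclNorm_eq_sqrt_dotProduct, Real.sq_sqrt (dotProduct_self_nonneg_real v)]

theorem exists_dotProduct_mulVec_self_le {κ : Type*} [Fintype κ] (A : Matrix κ ι ℝ) :
    ∃ G > 0, ∀ v : ι → ℝ, (A *ᵥ v) ⬝ᵥ (A *ᵥ v) ≤ G * (v ⬝ᵥ v) := by
  have hA : 0 ≤ ∑ i, ∑ j, A i j ^ 2 :=
    Finset.sum_nonneg fun i _ => Finset.sum_nonneg fun j _ => sq_nonneg _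
  refine ⟨∑ i, ∑ j, A i j ^ 2 + 1, by linarith, fun v => ?_⟩
  have h : (A *ᵥ v) ⬝ᵥ (A *ᵥ v) ≤ (∑ i, ∑ j, A i j ^ 2) * (v ⬝ᵥ v) := by
    rw [Finset.sum_mul]
    refine Finset.sum_le_sum fun i _ => ?_
    have := Finset.sum_mul_sq_le_sq_mul_sq Finset.univ (A i) v
    simpa only [mulVec, dotProduct, sq] using this
  linarith [dotProduct_self_nonneg_real v]

theorem exists_dotProduct_mulVec_le (A : Matrix ι ι ℝ) :
    ∃ g > 0, ∀ v : ι → ℝ, v ⬝ᵥ (A *ᵥ v) ≤ g * (v ⬝ᵥ v) := by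
  obtain ⟨G, hG, h⟩ := exists_dotProduct_mulVec_self_le A
  refine ⟨G + 1, by linarith, fun v => ?_⟩
  have h₁ := dotProduct_self_nonneg_real (v - A *ᵥ v)
  simp only [sub_dotProduct, dotProduct_sub, dotProduct_comm (A *ᵥ v) v] at h₁
  nlinarith [h v, dotProduct_self_nonneg_real v, dotProduct_self_nonneg_real (A *ᵥ v)]

variable [DecidableEq ι]

theorem Matrix.PosDef.exists_dotProduct_self_le_inv {A : Matrix ι ι ℝ} (hA : A.PosDef) :
    ∃ g > 0, ∀ v : ι → ℝ, v ⬝ᵥ v ≤ g * (v ⬝ᵥ (A⁻¹ *ᵥ v)) := by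
  obtain ⟨g, hg, h⟩ := exists_dotProduct_mulVec_le A
  refine ⟨g, hg, fun v => ?_⟩
  have hdet : IsUnit A.det := hA.det_pos.ne'.isUnit
  have hsymm : Aᵀ = A := by simpa using hA.isHermitian.eq
  have hAw : A *ᵥ (A⁻¹ *ᵥ v) = v := by
    rw [mulVec_mulVec, mul_nonsing_inv A hdet, one_mulVec]
  have h₁ := hA.posSemidef.dotProduct_mulVec_nonneg (g • (A⁻¹ *ᵥ v) - v)
  have hcross : (A⁻¹ *ᵥ v) ⬝ᵥ (A *ᵥ v) = v ⬝ᵥ v := by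
    rw [dotProduct_mulVec, ← mulVec_transpose, hsymm, hAw]
  simp only [star_trivial, mulVec_sub, mulVec_smul, hAw, sub_dotProduct, dotProduct_sub,
    smul_dotProduct, dotProduct_smul, hcross, smul_eq_mul, dotProduct_comm (A⁻¹ *ᵥ v) v] at h₁
  have h₂ := h v
  have h₃ : 0 ≤ g * (g * (v ⬝ᵥ (A⁻¹ *ᵥ v)) - v ⬝ᵥ v) := by nlinarith
  linarith [nonneg_of_mul_nonneg_right h₃ hg]

end EuclideanNorm

section Derivatives

variable {ι : Type*} [Fintype ι] {s : Set ℝ} {x : ℝ}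

theorem HasDerivWithinAt.dotProduct {f g : ℝ → ι → ℝ} {f' g' : ι → ℝ}
    (hf : HasDerivWithinAt f f' s x) (hg : HasDerivWithinAt g g' s x) :
    HasDerivWithinAt (fun t => f t ⬝ᵥ g t) (f' ⬝ᵥ g x + f x ⬝ᵥ g') s x := by
  have h := HasDerivWithinAt.fun_sum (u := Finset.univ) fun i _ =>
    (hasDerivWithinAt_pi.1 hf i).mul (hasDerivWithinAt_pi.1 hg i)
  rw [Finset.sum_add_distrib] at h
  exact h

theorem HasDerivWithinAt.const_mulVec {κ : Type*} (A : Matrix κ ι ℝ) {f : ℝ → ι → ℝ} {f' : ι → ℝ}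
    (hf : HasDerivWithinAt f f' s x) :
    HasDerivWithinAt (fun t => A *ᵥ f t) (A *ᵥ f') s x := by
  refine hasDerivWithinAt_pi.2 fun i => ?_
  simpa only [zero_dotProduct, zero_add, mulVec] using
    (hasDerivWithinAt_const x s (A i)).dotProduct hf

end Derivatives

theorem exp_mul_le_of_contraction_of_antitone {V : ℝ → ℝ} {T μ : ℝ} (hT : 0 < T) (hμ : 0 ≤ μ)
    (hV : ∀ t ≥ 0, 0 ≤ V t) (hanti : AntitoneOn V (Set.Ici 0))
    (hstep : ∀ t ≥ 0, Real.exp (μ * T) * V (t + T) ≤ V t) {t₀ t : ℝ} (ht₀ : 0 ≤ t₀)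
    (ht : t₀ ≤ t) : Real.exp (μ * (t - t₀)) * V t ≤ Real.exp (μ * T) * V t₀ := by
  obtain ⟨k, hk⟩ := exists_nat_ge ((t - t₀) / T)
  rw [div_le_iff₀ hT] at hk
  have hbase : ∀ t, t₀ ≤ t → t - t₀ ≤ T →
      Real.exp (μ * (t - t₀)) * V t ≤ Real.exp (μ * T) * V t₀ := fun t ht h =>
    mul_le_mul (Real.exp_le_exp.2 (mul_le_mul_of_nonneg_left h hμ))
      (hanti ht₀ (ht₀.trans ht) ht) (hV t (ht₀.trans ht)) (Real.exp_pos _).le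
  induction k generalizing t with
  | zero => exact hbase t ht (by simp at hk; linarith)
  | succ k ih =>
    rcases le_total (t - t₀) T with h | h
    · exact hbase t ht h
    · have h₁ := ih (t := t - T) (by linarith) (by push_cast at hk; linarith)
      have h₂ := hstep (t - T) (by linarith)
      rw [sub_add_cancel] at h₂
      calc Real.exp (μ * (t - t₀)) * V t
          = Real.exp (μ * (t - T - t₀)) * (Real.exp (μ * T) * V t) := by
            rw [← mul_assoc, ← Real.exp_add]; ring_nf
        _ ≤ Real.exp (μ * (t - T - t₀)) * V (t - T) := by gcongr
        _ ≤ _ := h₁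

section Estimator

variable {p n : ℕ} {C : ℝ → Matrix (Fin p) (Fin n) ℝ}

theorem IsPE.le_integral {α T : ℝ} (hPE : IsPE C α T)
    (hcont : ∀ i j, Continuous fun t => C t i j) {t : ℝ} (ht : 0 ≤ t) (v : Fin n → ℝ) :
    α * (v ⬝ᵥ v) ≤ ∫ τ in t..(t + T), (C τ *ᵥ v) ⬝ᵥ (C τ *ᵥ v) := by
  have h := (hPE t ht).dotProduct_mulVec_nonneg v
  have hcC : ∀ i j, Continuous fun τ => ((C τ)ᵀ * C τ) i j := fun i j => by
    simp only [mul_apply, transpose_apply]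
    exact continuous_finsetSum _ fun k _ => (hcont k i).mul (hcont k j)
  have hint : ∫ τ in t..(t + T), (C τ *ᵥ v) ⬝ᵥ (C τ *ᵥ v) =
      v ⬝ᵥ ((Matrix.of fun i j => ∫ τ in t..(t + T), ((C τ)ᵀ * C τ) i j) *ᵥ v) := by
    have hquad : ∀ τ, (C τ *ᵥ v) ⬝ᵥ (C τ *ᵥ v) =
        ∑ i, v i * ∑ j, ((C τ)ᵀ * C τ) i j * v j := fun τ => by
      rw [dotProduct_mulVec, ← mulVec_transpose, mulVec_mulVec, dotProduct_comm]
      rfl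
    simp only [hquad]
    have hentry : ∀ i j, Continuous fun τ => ((C τ)ᵀ * C τ) i j * v j := fun i j =>
      (hcC i j).mul continuous_const
    have hrow : ∀ i, Continuous fun τ => v i * ∑ j, ((C τ)ᵀ * C τ) i j * v j := fun i =>
      continuous_const.mul (continuous_finsetSum _ fun j _ => hentry i j)
    rw [intervalIntegral.integral_finsetSum fun i _ => (hrow i).intervalIntegrable _ _]
    refine Finset.sum_congr rfl fun i _ => ?_
    rw [intervalIntegral.integral_const_mul, intervalIntegral.integral_finsetSum
      fun j _ => (hentry i j).intervalIntegrable _ _]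
    simp only [intervalIntegral.integral_mul_const, mulVec, dotProduct, of_apply]
  rw [hint]
  simp only [star_trivial, sub_mulVec, smul_mulVec, one_mulVec, dotProduct_sub,
    dotProduct_smul, smul_eq_mul] at h
  linarith

/-- `θ` solves the gradient-estimator error dynamics on `[0, ∞)`. -/
def IsErrorTrajectory (Γ : Matrix (Fin n) (Fin n) ℝ) (C : ℝ → Matrix (Fin p) (Fin n) ℝ)
    (θ : ℝ → Fin n → ℝ) : Prop :=
  ∀ t ≥ (0 : ℝ), HasDerivWithinAt θ (-(Γ *ᵥ (((C t)ᵀ * C t) *ᵥ θ t))) (Set.Ici 0) t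

/-- The Lyapunov function `θᵀ Γ⁻¹ θ`. -/
noncomputable def lyapunov (Γ : Matrix (Fin n) (Fin n) ℝ) (θ : Fin n → ℝ) : ℝ :=
  θ ⬝ᵥ (Γ⁻¹ *ᵥ θ)

variable {Γ : Matrix (Fin n) (Fin n) ℝ} {θ : ℝ → Fin n → ℝ}

namespace IsErrorTrajectory

theorem hasDerivWithinAt_lyapunov (hθ : IsErrorTrajectory Γ C θ) (hΓ : Γ.PosDef) {t : ℝ}
    (ht : 0 ≤ t) :
    HasDerivWithinAt (fun t => lyapunov Γ (θ t)) (-(2 * ((C t *ᵥ θ t) ⬝ᵥ (C t *ᵥ θ t))))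
      (Set.Ici 0) t := by
  have hsymm : (Γ⁻¹)ᵀ = Γ⁻¹ := by simpa using hΓ.inv.isHermitian.eq
  have hcancel : ∀ v, Γ⁻¹ *ᵥ (Γ *ᵥ v) = v := fun v => by
    rw [mulVec_mulVec, nonsing_inv_mul Γ hΓ.det_pos.ne'.isUnit, one_mulVec]
  have hquad : (C t *ᵥ θ t) ⬝ᵥ (C t *ᵥ θ t) = θ t ⬝ᵥ (((C t)ᵀ * C t) *ᵥ θ t) := by
    rw [dotProduct_mulVec, ← mulVec_transpose, mulVec_mulVec, dotProduct_comm]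
  refine ((hθ t ht).dotProduct ((hθ t ht).const_mulVec Γ⁻¹)).congr_deriv ?_
  rw [dotProduct_mulVec _ Γ⁻¹ (θ t), ← mulVec_transpose, hsymm, mulVec_neg, hcancel,
    neg_dotProduct, dotProduct_neg, dotProduct_comm _ (θ t), hquad]
  ring

theorem continuousOn (hθ : IsErrorTrajectory Γ C θ) : ContinuousOn θ (Set.Ici 0) :=
  fun t ht => (hθ t ht).continuousWithinAt

theorem continuousOn_lyapunov (hθ : IsErrorTrajectory Γ C θ) (hΓ : Γ.PosDef) :
    ContinuousOn (fun t => lyapunov Γ (θ t)) (Set.Ici 0) :=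
  fun _ ht => (hθ.hasDerivWithinAt_lyapunov hΓ ht).continuousWithinAt

theorem antitoneOn_lyapunov (hθ : IsErrorTrajectory Γ C θ) (hΓ : Γ.PosDef) :
    AntitoneOn (fun t => lyapunov Γ (θ t)) (Set.Ici 0) :=
  antitoneOn_of_hasDerivWithinAt_nonpos (convex_Ici 0) (hθ.continuousOn_lyapunov hΓ)
    (fun _ ht => (hθ.hasDerivWithinAt_lyapunov hΓ (interior_subset ht)).mono interior_subset)
    fun t _ => by linarith [dotProduct_self_nonneg_real (C t *ᵥ θ t)]

theorem displacement_le (hθ : IsErrorTrajectory Γ C θ) (hΓ : Γ.PosDef) {b G T : ℝ}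
    (hb : 0 < b) (hG : 0 < G) (hT : 0 < T)
    (hC : ∀ t ≥ 0, ∀ v, (C t *ᵥ v) ⬝ᵥ (C t *ᵥ v) ≤ b * (v ⬝ᵥ v))
    (hΓG : ∀ v, (Γ *ᵥ v) ⬝ᵥ (Γ *ᵥ v) ≤ G * (v ⬝ᵥ v))
    {s t : ℝ} (hs : 0 ≤ s) (hst : s ≤ t) (htT : t ≤ s + T) :
    (θ t - θ s) ⬝ᵥ (θ t - θ s) ≤ b * G * T / 2 * (lyapunov Γ (θ s) - lyapunov Γ (θ t)) := by
  have hsymm : Γᵀ = Γ := by simpa using hΓ.isHermitian.eq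
  set w := θ t - θ s with hw
  set K := b * G * T with hK
  have hKpos : 0 < K := by positivity
  have hderiv : ∀ τ ≥ 0, HasDerivWithinAt
      (fun τ => w ⬝ᵥ θ τ + K / 4 * lyapunov Γ (θ τ) - τ * (w ⬝ᵥ w / (2 * T)))
      (-((C τ *ᵥ (Γ *ᵥ w)) ⬝ᵥ (C τ *ᵥ θ τ)) +
        K / 4 * (-(2 * ((C τ *ᵥ θ τ) ⬝ᵥ (C τ *ᵥ θ τ)))) - 1 * (w ⬝ᵥ w / (2 * T)))
      (Set.Ici 0) τ := fun τ hτ => by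
    refine ((HasDerivWithinAt.congr_deriv
      ((hasDerivWithinAt_const τ (Set.Ici 0) w).dotProduct (hθ τ hτ)) ?_).add
      ((hθ.hasDerivWithinAt_lyapunov hΓ hτ).const_mul (K / 4))).sub
      ((hasDerivWithinAt_id τ _).mul_const _)
    rw [zero_dotProduct, zero_add, dotProduct_neg, dotProduct_mulVec w, ← mulVec_transpose, hsymm,
      ← mulVec_mulVec, dotProduct_mulVec _ (C τ)ᵀ, vecMul_transpose]
  have hanti := antitoneOn_of_hasDerivWithinAt_nonpos (convex_Ici 0)
    (fun τ hτ => (hderiv τ hτ).continuousWithinAt)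
    (fun τ hτ => (hderiv τ (interior_subset hτ)).mono interior_subset) fun τ hτ => by
      have hτ' : (0 : ℝ) ≤ τ := interior_subset (s := Set.Ici (0 : ℝ)) hτ
      have h₁ := dotProduct_self_nonneg_real (K • (C τ *ᵥ θ τ) + C τ *ᵥ (Γ *ᵥ w))
      simp only [add_dotProduct, dotProduct_add, smul_dotProduct, dotProduct_smul, smul_eq_mul,
        dotProduct_comm (C τ *ᵥ θ τ) (C τ *ᵥ (Γ *ᵥ w))] at h₁
      have h₂ := hC τ hτ' (Γ *ᵥ w)
      have h₃ := mul_le_mul_of_nonneg_left (hΓG w) hb.le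
      have h₄ : w ⬝ᵥ w / (2 * T) = b * G * (w ⬝ᵥ w) / (2 * K) := by
        rw [hK]; field_simp
      have h₅ : (C τ *ᵥ (Γ *ᵥ w)) ⬝ᵥ (C τ *ᵥ (Γ *ᵥ w)) / (2 * K) ≤ w ⬝ᵥ w / (2 * T) := by
        rw [h₄]; gcongr; linarith
      have h₆ := div_nonneg h₁ (by positivity : 0 ≤ 2 * K)
      have h₇ : ∀ z u c : ℝ, (K * (K * z + c) + (K * c + u)) / (2 * K)
          = K / 2 * z + c + u / (2 * K) := fun z u c => by field_simp; ring
      rw [h₇] at h₆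
      linarith
  have hle := hanti (a := s) (b := t) hs (hs.trans hst) hst
  have hwd : w ⬝ᵥ θ t - w ⬝ᵥ θ s = w ⬝ᵥ w := by rw [← dotProduct_sub]
  have hwT : (t - s) * (w ⬝ᵥ w / (2 * T)) ≤ T * (w ⬝ᵥ w / (2 * T)) :=
    mul_le_mul_of_nonneg_right (by linarith)
      (div_nonneg (dotProduct_self_nonneg_real w) (by positivity))
  have hhalf : T * (w ⬝ᵥ w / (2 * T)) = w ⬝ᵥ w / 2 := by field_simp
  simp only at hle
  linarith

theorem le_lyapunov_decrease (hθ : IsErrorTrajectory Γ C θ) (hΓ : Γ.PosDef) {α b G T : ℝ}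
    (hb : 0 < b) (hG : 0 < G) (hT : 0 < T)
    (hcont : ∀ i j, Continuous fun t => C t i j) (hPE : IsPE C α T)
    (hC : ∀ t ≥ 0, ∀ v, (C t *ᵥ v) ⬝ᵥ (C t *ᵥ v) ≤ b * (v ⬝ᵥ v))
    (hΓG : ∀ v, (Γ *ᵥ v) ⬝ᵥ (Γ *ᵥ v) ≤ G * (v ⬝ᵥ v)) {t : ℝ} (ht : 0 ≤ t) :
    α * (θ t ⬝ᵥ θ t) ≤
      (1 + b ^ 2 * G * T ^ 2) * (lyapunov Γ (θ t) - lyapunov Γ (θ (t + T))) := by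
  set D := lyapunov Γ (θ t) - lyapunov Γ (θ (t + T)) with hD
  have hCcont : Continuous C := continuous_matrix hcont
  have hsub : Set.Icc t (t + T) ⊆ Set.Ici 0 := fun τ hτ => ht.trans hτ.1
  have htT : t ≤ t + T := by linarith
  have hycont : ContinuousOn (fun τ => 2 * ((C τ *ᵥ θ τ) ⬝ᵥ (C τ *ᵥ θ τ)))
      (Set.Icc t (t + T)) := by
    rw [continuousOn_iff_continuous_domRestrict]
    have hθc := continuousOn_iff_continuous_domRestrict.1 (hθ.continuousOn.mono hsub)
    have hz : Continuous fun τ : Set.Icc t (t + T) => C τ *ᵥ θ τ :=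
      (hCcont.comp continuous_subtype_val).matrix_mulVec hθc
    exact continuous_const.mul (hz.dotProduct hz)
  have hyint : IntervalIntegrable (fun τ => 2 * ((C τ *ᵥ θ τ) ⬝ᵥ (C τ *ᵥ θ τ)))
      volume t (t + T) := by
    refine ContinuousOn.intervalIntegrable ?_
    rwa [Set.uIcc_of_le htT]
  have hFTC : ∫ τ in t..(t + T), 2 * ((C τ *ᵥ θ τ) ⬝ᵥ (C τ *ᵥ θ τ)) = D := by
    have h := intervalIntegral.integral_eq_sub_of_hasDerivAt_of_le htT
      ((hθ.continuousOn_lyapunov hΓ).mono hsub)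
      (fun τ hτ => (hθ.hasDerivWithinAt_lyapunov hΓ (ht.trans hτ.1.le)).hasDerivAt
        (Ici_mem_nhds (ht.trans_lt hτ.1))) hyint.neg
    rw [intervalIntegral.integral_neg] at h
    linarith
  have hpoint : ∀ τ ∈ Set.Icc t (t + T), (C τ *ᵥ θ t) ⬝ᵥ (C τ *ᵥ θ t) ≤
      2 * ((C τ *ᵥ θ τ) ⬝ᵥ (C τ *ᵥ θ τ)) + b ^ 2 * G * T * D := fun τ hτ => by
    have h₁ := hθ.displacement_le hΓ hb hG hT hC hΓG ht hτ.1 hτ.2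
    have h₂ := hθ.antitoneOn_lyapunov hΓ (hsub hτ) (Set.mem_Ici.2 (ht.trans htT)) hτ.2
    have h₃ := hC τ (hsub hτ) (θ τ - θ t)
    have h₄ : b * G * T / 2 * (lyapunov Γ (θ t) - lyapunov Γ (θ τ)) ≤ b * G * T / 2 * D := by
      gcongr
      simp only at h₂
      linarith
    have h₅ := mul_le_mul_of_nonneg_left (h₁.trans h₄) hb.le
    have h₆ := dotProduct_self_nonneg_real (C τ *ᵥ θ τ + C τ *ᵥ (θ τ - θ t))
    simp only [mulVec_sub, add_dotProduct, dotProduct_add, sub_dotProduct, dotProduct_sub,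
      dotProduct_comm (C τ *ᵥ θ t) (C τ *ᵥ θ τ)] at h₃ h₆ h₅
    linarith
  have hle : ∫ τ in t..(t + T), (C τ *ᵥ θ t) ⬝ᵥ (C τ *ᵥ θ t) ≤
      ∫ τ in t..(t + T), (2 * ((C τ *ᵥ θ τ) ⬝ᵥ (C τ *ᵥ θ τ)) + b ^ 2 * G * T * D) := by
    have hz : Continuous fun τ => C τ *ᵥ θ t := hCcont.matrix_mulVec continuous_const
    exact intervalIntegral.integral_mono_on htT ((hz.dotProduct hz).intervalIntegrable _ _)
      (hyint.add intervalIntegrable_const) hpoint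
  rw [intervalIntegral.integral_add hyint intervalIntegrable_const, hFTC,
    intervalIntegral.integral_const, smul_eq_mul] at hle
  linarith [hPE.le_integral hcont ht (θ t)]

end IsErrorTrajectory

end Estimator

/-- Under PE of the bounded regressor `C`, the gradient-estimator
error dynamics `θ̃' = −Γ CᵀC θ̃` is globally uniformly exponentially stable. -/
theorem gradient_estimator_GUES (p n : ℕ) (α T β : ℝ)
    (hα : 0 < α) (hT : 0 < T) (hβ : 0 < β)
    (Γ : Matrix (Fin n) (Fin n) ℝ) (hΓ : Γ.PosDef)
    (C : ℝ → Matrix (Fin p) (Fin n) ℝ)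
    (hcont : ∀ i j, Continuous fun t => C t i j)
    (hbound : ∀ t ≥ (0 : ℝ), ∀ v : Fin n → ℝ,
      euclNorm ((C t).mulVec v) ≤ β * euclNorm v)
    (hPE : IsPE C α T) :
    ∃ κ > (0 : ℝ), ∃ lam > (0 : ℝ),
      ∀ θtil : ℝ → (Fin n → ℝ),
        (∀ t ≥ (0 : ℝ), HasDerivWithinAt θtil
          (-(Γ.mulVec (((C t)ᵀ * C t).mulVec (θtil t)))) (Set.Ici 0) t) →
        ∀ t₀ t : ℝ, 0 ≤ t₀ → t₀ ≤ t →
          euclNorm (θtil t) ≤ κ * Real.exp (-lam * (t - t₀)) * euclNorm (θtil t₀) := by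
  obtain ⟨G, hG, hΓG⟩ := exists_dotProduct_mulVec_self_le Γ
  obtain ⟨c, hc, hupper⟩ := exists_dotProduct_mulVec_le Γ⁻¹
  obtain ⟨g, hg, hlower⟩ := hΓ.exists_dotProduct_self_le_inv
  have hC : ∀ t ≥ 0, ∀ v, (C t *ᵥ v) ⬝ᵥ (C t *ᵥ v) ≤ β ^ 2 * (v ⬝ᵥ v) := fun t ht v => by
    rw [← euclNorm_sq, ← euclNorm_sq, ← mul_pow]
    exact pow_le_pow_left₀ (euclNorm_nonneg _) (hbound t ht v) 2
  set M := 1 + (β ^ 2) ^ 2 * G * T ^ 2 with hM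
  have hMpos : 0 < M := by positivity
  set δ := α / (c * M) with hδ
  have hδpos : 0 < δ := by positivity
  set μ := Real.log (1 + δ) / T with hμ
  have hμpos : 0 < μ := div_pos (Real.log_pos (by linarith)) hT
  have hexp : Real.exp (μ * T) = 1 + δ := by
    rw [hμ, div_mul_cancel₀ _ hT.ne', Real.exp_log (by linarith)]
  refine ⟨Real.sqrt (g * c * Real.exp (μ * T)), Real.sqrt_pos.2 (by positivity), μ / 2,
    by positivity, fun θ hθ t₀ t ht₀ ht => ?_⟩
  replace hθ : IsErrorTrajectory Γ C θ := hθ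
  have hanti := hθ.antitoneOn_lyapunov hΓ
  have hnonneg : ∀ t, 0 ≤ lyapunov Γ (θ t) := fun t =>
    hΓ.inv.posSemidef.dotProduct_mulVec_nonneg (θ t)
  have hstep : ∀ t ≥ 0, Real.exp (μ * T) * lyapunov Γ (θ (t + T)) ≤ lyapunov Γ (θ t) :=
    fun t ht => by
      have h₁ := hθ.le_lyapunov_decrease hΓ (by positivity) hG hT hcont hPE hC hΓG ht
      have h₂ : lyapunov Γ (θ (t + T)) ≤ c * (θ t ⬝ᵥ θ t) :=
        (hanti ht (Set.mem_Ici.2 (by linarith)) (by linarith)).trans (hupper (θ t))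
      have h₃ : δ * lyapunov Γ (θ (t + T)) ≤ lyapunov Γ (θ t) - lyapunov Γ (θ (t + T)) := by
        rw [hδ, div_mul_eq_mul_div, div_le_iff₀ (by positivity)]
        nlinarith [mul_le_mul_of_nonneg_left h₂ hα.le, mul_le_mul_of_nonneg_left h₁ hc.le]
      rw [hexp]
      linarith
  have hdecay := exp_mul_le_of_contraction_of_antitone hT hμpos.le (fun t _ => hnonneg t) hanti
    hstep ht₀ ht
  have hsq : θ t ⬝ᵥ θ t ≤
      g * c * Real.exp (μ * T) * Real.exp (-(μ / 2) * (t - t₀)) ^ 2 * (θ t₀ ⬝ᵥ θ t₀) := by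
    have hexp_sq : Real.exp (-(μ / 2) * (t - t₀)) ^ 2 = Real.exp (-(μ * (t - t₀))) := by
      rw [← Real.exp_nat_mul]; congr 1; push_cast; ring
    calc θ t ⬝ᵥ θ t ≤ g * lyapunov Γ (θ t) := hlower (θ t)
      _ = g * (Real.exp (-(μ * (t - t₀))) * (Real.exp (μ * (t - t₀)) * lyapunov Γ (θ t))) := by
        rw [← mul_assoc (Real.exp _), ← Real.exp_add, neg_add_cancel, Real.exp_zero, one_mul]
      _ ≤ g * (Real.exp (-(μ * (t - t₀))) *
          (Real.exp (μ * T) * (c * (θ t₀ ⬝ᵥ θ t₀)))) := by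
        refine mul_le_mul_of_nonneg_left (mul_le_mul_of_nonneg_left ?_ (Real.exp_pos _).le) hg.le
        exact hdecay.trans (mul_le_mul_of_nonneg_left (hupper (θ t₀)) (Real.exp_pos _).le)
      _ = _ := by rw [hexp_sq]; ring
  refine abs_le_of_sq_le_sq' ?_ (mul_nonneg (by positivity) (euclNorm_nonneg _)) |>.2
  rw [mul_pow, mul_pow, Real.sq_sqrt (by positivity), euclNorm_sq, euclNorm_sq]
  exact hsq
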